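/- arXiv:2309.03859 — 7 statements merged into one kernel-verified Lean document; each statement's English description precedes it below -/
import Mathlib

section
/- Let α ∈ ℝ with α ≠ 0, and let K^x, K^y, K^z : ℝ³ → ℝ be smooth functions satisfying the Killing equations of H³(-α²) at every point (x,y,z): ∂_x K^x = α K^z, ∂_y K^y = α K^z, e^{-2αz} ∂_z K^y + ∂_y K^z = 0, ∂_y K^x + ∂_x K^y = 0, e^{-2αz} ∂_z K^x + ∂_x K^z = 0, and ∂_z K^z = 0. Then there exist constants c₁, c₂, c₃, c₄, c₅, c₆ ∈ ℝ such that for all (x,y,z): K^x(x,y,z) = c₁((α/2)(x² - y²) - e^{2αz}/(2α)) + c₂ αxy + c₃ αx + c₄ y + c₅, K^y(x,y,z) = c₂((α/2)(y² - x²) - e^{2αz}/(2α)) + c₁ αxy + c₃ αy - c₄ x + c₆, and K^z(x,y,z) = c₁ x + c₂ y + c₃. -/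
lemma aux_eq (u v u' : ℝ → ℝ) (hu : ∀ t, HasDerivAt u (u' t) t)
    (hv : ∀ t, HasDerivAt v (u' t) t) (t : ℝ) : u t = u 0 + (v t - v 0) := by
  have h : ∀ t, HasDerivAt (fun t => u t - v t) 0 t := fun t => by
    exact ((hu t).sub (hv t)).congr_deriv (sub_self _)
  have := is_const_of_deriv_eq_zero (fun t => (h t).differentiableAt) (fun t => (h t).deriv) t 0
  linarith

lemma aux_quad (u : ℝ → ℝ) (a b : ℝ) (hu : ∀ t, HasDerivAt u (a * t + b) t) (t : ℝ) :
    u t = u 0 + (a / 2 * t ^ 2 + b * t) := by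
  have := aux_eq u (fun t => a / 2 * t ^ 2 + b * t) (fun t => a * t + b) hu (fun t => by
    have h := (((hasDerivAt_id t).pow 2).const_mul (a / 2)).add ((hasDerivAt_id t).const_mul b)
    refine HasDerivAt.congr_deriv h ?_
    simp
    ring) t
  simpa using this

lemma aux_exp (α : ℝ) (hα : α ≠ 0) (u : ℝ → ℝ) (a : ℝ)
    (hu : ∀ t, HasDerivAt u (-(a * Real.exp (2 * α * t))) t) (t : ℝ) :
    u t = u 0 - a * ((Real.exp (2 * α * t) - 1) / (2 * α)) := by
  have := aux_eq u (fun t => -(a * (Real.exp (2 * α * t) / (2 * α)))) _ hu (fun t => by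
    have h := (((((hasDerivAt_id t).const_mul (2 * α)).exp).div_const (2 * α)).const_mul a).neg
    refine HasDerivAt.congr_deriv h ?_
    simp
    field_simp
    simp) t
  simp at this
  rw [this]
  ring

lemma aux_diff (K : ℝ → ℝ → ℝ → ℝ)
    (h : ContDiff ℝ (⊤ : ℕ∞) (fun p : ℝ × ℝ × ℝ => K p.1 p.2.1 p.2.2)) (x y z : ℝ) :
    HasDerivAt (fun s => K s y z) (deriv (fun s => K s y z) x) x ∧
    HasDerivAt (fun s => K x s z) (deriv (fun s => K x s z) y) y ∧
    HasDerivAt (fun s => K x y s) (deriv (fun s => K x y s) z) z := by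
  have hd : Differentiable ℝ (fun p : ℝ × ℝ × ℝ => K p.1 p.2.1 p.2.2) :=
    h.differentiable (by simp)
  refine ⟨DifferentiableAt.hasDerivAt ?_, DifferentiableAt.hasDerivAt ?_,
    DifferentiableAt.hasDerivAt ?_⟩
  · exact (hd.comp (f := fun s : ℝ => (s, y, z)) (by fun_prop)) x
  · exact (hd.comp (f := fun s : ℝ => (x, s, z)) (by fun_prop)) y
  · exact (hd.comp (f := fun s : ℝ => (x, y, s)) (by fun_prop)) z

theorem killing_fields_classification (α : ℝ) (hα : α ≠ 0)
    (Kx Ky Kz : ℝ → ℝ → ℝ → ℝ)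
    (hKxs : ContDiff ℝ (⊤ : ℕ∞) (fun p : ℝ × ℝ × ℝ => Kx p.1 p.2.1 p.2.2))
    (hKys : ContDiff ℝ (⊤ : ℕ∞) (fun p : ℝ × ℝ × ℝ => Ky p.1 p.2.1 p.2.2))
    (hKzs : ContDiff ℝ (⊤ : ℕ∞) (fun p : ℝ × ℝ × ℝ => Kz p.1 p.2.1 p.2.2))
    (heq : ∀ x y z : ℝ,
      deriv (fun s => Kx s y z) x = α * Kz x y z ∧
      deriv (fun s => Ky x s z) y = α * Kz x y z ∧
      Real.exp (-2 * α * z) * deriv (fun s => Ky x y s) z +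
        deriv (fun s => Kz x s z) y = 0 ∧
      deriv (fun s => Kx x s z) y + deriv (fun s => Ky s y z) x = 0 ∧
      Real.exp (-2 * α * z) * deriv (fun s => Kx x y s) z +
        deriv (fun s => Kz s y z) x = 0 ∧
      deriv (fun s => Kz x y s) z = 0) :
    ∃ c₁ c₂ c₃ c₄ c₅ c₆ : ℝ, ∀ x y z : ℝ,
      Kx x y z = c₁ * (α / 2 * (x ^ 2 - y ^ 2) - Real.exp (2 * α * z) / (2 * α)) +
        c₂ * (α * x * y) + c₃ * (α * x) + c₄ * y + c₅ ∧
      Ky x y z = c₂ * (α / 2 * (y ^ 2 - x ^ 2) - Real.exp (2 * α * z) / (2 * α)) +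
        c₁ * (α * x * y) + c₃ * (α * y) - c₄ * x + c₆ ∧
      Kz x y z = c₁ * x + c₂ * y + c₃ := by
  have dX := aux_diff Kx hKxs
  have dY := aux_diff Ky hKys
  have dZ := aux_diff Kz hKzs
  have hE : ∀ z, Real.exp (2 * α * z) * Real.exp (-2 * α * z) = 1 := fun z => by
    rw [← Real.exp_add]; simp
  -- Kz does not depend on z
  have hz : ∀ x y z, Kz x y z = Kz x y 0 := fun x y z => by
    have := aux_quad (fun s => Kz x y s) 0 0 (fun t => by
      have h := (dZ x y t).2.2
      rw [(heq x y t).2.2.2.2.2] at h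
      simpa using h) z
    simpa using this
  obtain ⟨f, hf⟩ : ∃ f : ℝ → ℝ → ℝ, ∀ x y z, Kz x y z = f x y := ⟨fun x y => Kz x y 0, hz⟩
  obtain rfl : Kz = fun x y _ => f x y := by funext x y z; exact hf x y z
  simp only at heq dZ
  set fx : ℝ → ℝ → ℝ := fun x y => deriv (fun s => f s y) x with hfx
  set fy : ℝ → ℝ → ℝ := fun x y => deriv (fun s => f x s) y with hfy
  have dfx : ∀ x y, HasDerivAt (fun s => f s y) (fx x y) x := fun x y => (dZ x y 0).1
  have dfy : ∀ x y, HasDerivAt (fun s => f x s) (fy x y) y := fun x y => (dZ x y 0).2.1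
  have hX : ∀ x y z, Kx x y z = Kx x y 0 - fx x y * ((Real.exp (2 * α * z) - 1) / (2 * α)) :=
    fun x y z => aux_exp α hα (fun s => Kx x y s) (fx x y) (fun t => by
      have h := (dX x y t).2.2
      convert h using 1
      have h5 := (heq x y t).2.2.2.2.1
      change _ + fx x y = 0 at h5
      linear_combination (-Real.exp (2 * α * t)) * h5 + deriv (fun s => Kx x y s) t * hE t) z
  have hY : ∀ x y z, Ky x y z = Ky x y 0 - fy x y * ((Real.exp (2 * α * z) - 1) / (2 * α)) :=
    fun x y z => aux_exp α hα (fun s => Ky x y s) (fy x y) (fun t => by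
      have h := (dY x y t).2.2
      convert h using 1
      have h5 := (heq x y t).2.2.1
      change _ + fy x y = 0 at h5
      linear_combination (-Real.exp (2 * α * t)) * h5 + deriv (fun s => Ky x y s) t * hE t) z
  obtain ⟨l, hl⟩ : ∃ l : ℝ, l * ((Real.exp (2 * α * 1) - 1) / (2 * α)) = 1 := by
    refine ⟨((Real.exp (2 * α * 1) - 1) / (2 * α))⁻¹, inv_mul_cancel₀ ?_⟩
    refine div_ne_zero ?_ (by simpa using hα)
    rw [sub_ne_zero, Ne, Real.exp_eq_one_iff]
    simpa using hα
  have hfx' : ∀ x y, fx x y = l * (Kx x y 0 - Kx x y 1) := fun x y => by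
    rw [hX x y 1]; linear_combination (-fx x y) * hl
  have hfy' : ∀ x y, fy x y = l * (Ky x y 0 - Ky x y 1) := fun x y => by
    rw [hY x y 1]; linear_combination (-fy x y) * hl
  have fxx : ∀ x y, fx x y = fx 0 y := fun x y => by
    have := aux_quad (fun s => fx s y) 0 0 (fun t => by
      simp only [hfx']
      have h := ((dX t y 0).1.sub (dX t y 1).1).const_mul l
      rw [(heq t y 0).1, (heq t y 1).1] at h
      refine HasDerivAt.congr_deriv h ?_
      ring) x
    simpa using this
  have fyy : ∀ x y, fy x y = fy x 0 := fun x y => by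
    have := aux_quad (fun s => fy x s) 0 0 (fun t => by
      simp only [hfy']
      have h := ((dY x t 0).2.1.sub (dY x t 1).2.1).const_mul l
      rw [(heq x t 0).2.1, (heq x t 1).2.1] at h
      refine HasDerivAt.congr_deriv h ?_
      ring) y
    simpa using this
  have dfxy : ∀ x y, HasDerivAt (fun s => fx x s)
      (l * (deriv (fun s => Kx x s 0) y - deriv (fun s => Kx x s 1) y)) y := fun x y => by
    simp only [hfx']
    exact ((dX x y 0).2.1.sub (dX x y 1).2.1).const_mul l
  have dfyx : ∀ x y, HasDerivAt (fun s => fy s y)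
      (-(l * (deriv (fun s => Kx x s 0) y - deriv (fun s => Kx x s 1) y))) x := fun x y => by
    simp only [hfy']
    have h := ((dY x y 0).1.sub (dY x y 1).1).const_mul l
    refine HasDerivAt.congr_deriv h ?_
    linear_combination l * (heq x y 0).2.2.2.1 - l * (heq x y 1).2.2.2.1
  obtain ⟨m, hm⟩ : ∃ m : ℝ → ℝ → ℝ, ∀ x y,
      HasDerivAt (fun s => fx x s) (m x y) y ∧ HasDerivAt (fun s => fy s y) (-(m x y)) x :=
    ⟨_, fun x y => ⟨dfxy x y, dfyx x y⟩⟩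
  have m1 : ∀ x y, m x y = m 0 y := fun x y => by
    have h := (hm x y).1
    simp only [fxx x] at h
    exact h.unique (hm 0 y).1
  have m2 : ∀ x y, m x y = m x 0 := fun x y => by
    have h := (hm x y).2
    simp only [fun s => fyy s y] at h
    exact neg_injective (h.unique (hm x 0).2)
  have mc : ∀ x y, m x y = m 0 0 := fun x y => by rw [m1, m2]
  have ha : ∀ y, fx 0 y = fx 0 0 + m 0 0 * y := fun y => by
    have := aux_quad (fun s => fx 0 s) 0 (m 0 0) (fun t => by
      have h := (hm 0 t).1
      rw [mc] at h
      simpa using h) y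
    simpa using this
  have hb : ∀ x, fy x 0 = fy 0 0 - m 0 0 * x := fun x => by
    have := aux_quad (fun s => fy s 0) 0 (-m 0 0) (fun t => by
      have h := (hm t 0).2
      rw [mc] at h
      simpa using h) x
    simp at this
    rw [this]; ring
  have hf1 : ∀ x y, f x y = f 0 y + fx 0 y * x := fun x y => by
    have := aux_quad (fun s => f s y) 0 (fx 0 y) (fun t => by
      have h := dfx t y
      rw [fxx] at h
      simpa using h) x
    simpa using this
  have hf2 : ∀ x y, f x y = f x 0 + fy x 0 * y := fun x y => by
    have := aux_quad (fun s => f x s) 0 (fy x 0) (fun t => by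
      have h := dfy x t
      rw [fyy] at h
      simpa using h) y
    simpa using this
  have hm0 : m 0 0 = 0 := by
    have e1 := hf1 1 1
    have e2 := hf2 1 1
    have e3 := hf1 1 0
    have e4 := hf2 0 1
    rw [ha 1] at e1
    rw [hb 1] at e2
    linarith
  obtain ⟨c1, hc1⟩ : ∃ c, c = fx 0 0 := ⟨_, rfl⟩
  obtain ⟨c2, hc2⟩ : ∃ c, c = fy 0 0 := ⟨_, rfl⟩
  obtain ⟨c3, hc3⟩ : ∃ c, c = f 0 0 := ⟨_, rfl⟩
  have Hfx : ∀ x y, fx x y = c1 := fun x y => by rw [fxx, ha, hm0, hc1]; ring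
  have Hfy : ∀ x y, fy x y = c2 := fun x y => by rw [fyy, hb, hm0, hc2]; ring
  have Hf : ∀ x y, f x y = c1 * x + c2 * y + c3 := fun x y => by
    rw [hf1, hf2, Hfx, Hfy, hc3]; ring
  have X1 : ∀ x y, Kx x y 0 = Kx 0 y 0 + (α * c1 / 2 * x ^ 2 + α * (c2 * y + c3) * x) :=
    fun x y => aux_quad (fun s => Kx s y 0) (α * c1) (α * (c2 * y + c3)) (fun t => by
      have h := (dX t y 0).1
      rw [(heq t y 0).1, Hf] at h
      refine HasDerivAt.congr_deriv h ?_
      ring) x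
  have Y1 : ∀ x y, Ky x y 0 = Ky x 0 0 + (α * c2 / 2 * y ^ 2 + α * (c1 * x + c3) * y) :=
    fun x y => aux_quad (fun s => Ky x s 0) (α * c2) (α * (c1 * x + c3)) (fun t => by
      have h := (dY x t 0).2.1
      rw [(heq x t 0).2.1, Hf] at h
      refine HasDerivAt.congr_deriv h ?_
      ring) y
  obtain ⟨G, hG⟩ : ∃ G : ℝ → ℝ, ∀ y, G y = deriv (fun s => Kx 0 s 0) y := ⟨_, fun _ => rfl⟩
  obtain ⟨H, hH⟩ : ∃ H : ℝ → ℝ, ∀ y, H y = deriv (fun s => Ky s 0 0) y := ⟨_, fun _ => rfl⟩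
  have dG : ∀ y, HasDerivAt (fun s => Kx 0 s 0) (G y) y := fun y => by
    rw [hG]; exact (dX 0 y 0).2.1
  have dH : ∀ x, HasDerivAt (fun s => Ky s 0 0) (H x) x := fun x => by
    rw [hH]; exact (dY x 0 0).1
  have X2 : ∀ x y, deriv (fun s => Kx x s 0) y = G y + α * c2 * x := fun x y => by
    have h := (dG y).add ((((((hasDerivAt_id y).const_mul c2).add_const c3).const_mul α).mul_const
      x).const_add (α * c1 / 2 * x ^ 2))
    rw [show (fun s => Kx x s 0) = _ from funext fun s => X1 x s]
    refine Eq.trans (HasDerivAt.deriv h) ?_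
    ring
  have Y2 : ∀ x y, deriv (fun s => Ky s y 0) x = H x + α * c1 * y := fun x y => by
    have h := (dH x).add ((((((hasDerivAt_id x).const_mul c1).add_const c3).const_mul α).mul_const
      y).const_add (α * c2 / 2 * y ^ 2))
    rw [show (fun s => Ky s y 0) = _ from funext fun s => Y1 s y]
    refine Eq.trans (HasDerivAt.deriv h) ?_
    ring
  have hGH : ∀ x y, G y + α * c2 * x + (H x + α * c1 * y) = 0 := fun x y => by
    rw [← X2, ← Y2]; exact (heq x y 0).2.2.2.1
  have hGv : ∀ y, Kx 0 y 0 = Kx 0 0 0 + (-(α * c1) / 2 * y ^ 2 + G 0 * y) :=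
    fun y => aux_quad (fun s => Kx 0 s 0) (-(α * c1)) (G 0) (fun t => by
      convert dG t using 1
      linear_combination hGH 0 0 - hGH 0 t) y
  have hHv : ∀ x, Ky x 0 0 = Ky 0 0 0 + (-(α * c2) / 2 * x ^ 2 + (-G 0) * x) :=
    fun x => aux_quad (fun s => Ky s 0 0) (-(α * c2)) (-G 0) (fun t => by
      convert dH t using 1
      linear_combination -hGH t 0) x
  refine ⟨c1, c2, c3, G 0, Kx 0 0 0 + c1 / (2 * α), Ky 0 0 0 + c2 / (2 * α), fun x y z =>
    ⟨?_, ?_, Hf x y⟩⟩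
  · rw [hX, X1, hGv, Hfx]; ring
  · rw [hY, Y1, hHv, Hfy]; ring
end

section
/- Let α ∈ ℝ with α ≠ 0. Consider the six vector fields on ℝ³ (as functions ℝ³ → ℝ³): K₁(x,y,z) = (1,0,0), K₂(x,y,z) = (0,1,0), K₃(x,y,z) = (y,-x,0), K₄(x,y,z) = (αx, αy, 1), K₅(x,y,z) = ((α/2)(x²-y²) - e^{2αz}/(2α), αxy, x), K₆(x,y,z) = (αxy, (α/2)(y²-x²) - e^{2αz}/(2α), y). If a₁, ..., a₆ ∈ ℝ satisfy a₁K₁(p) + a₂K₂(p) + a₃K₃(p) + a₄K₄(p) + a₅K₅(p) + a₆K₆(p) = 0 for every p ∈ ℝ³, then a₁ = a₂ = a₃ = a₄ = a₅ = a₆ = 0. Hence H³(-α²) has 6 = 3·(3+1)/2 linearly independent Killing vector fields. -/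
theorem killing_fields_linearly_independent (α : ℝ) (hα : α ≠ 0)
    (K₁ K₂ K₃ K₄ K₅ K₆ : ℝ × ℝ × ℝ → ℝ × ℝ × ℝ)
    (hK₁ : ∀ x y z : ℝ, K₁ (x, y, z) = (1, 0, 0))
    (hK₂ : ∀ x y z : ℝ, K₂ (x, y, z) = (0, 1, 0))
    (hK₃ : ∀ x y z : ℝ, K₃ (x, y, z) = (y, -x, 0))
    (hK₄ : ∀ x y z : ℝ, K₄ (x, y, z) = (α * x, α * y, 1))
    (hK₅ : ∀ x y z : ℝ, K₅ (x, y, z) =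
      (α / 2 * (x ^ 2 - y ^ 2) - Real.exp (2 * α * z) / (2 * α), α * x * y, x))
    (hK₆ : ∀ x y z : ℝ, K₆ (x, y, z) =
      (α * x * y, α / 2 * (y ^ 2 - x ^ 2) - Real.exp (2 * α * z) / (2 * α), y))
    (a₁ a₂ a₃ a₄ a₅ a₆ : ℝ)
    (hsum : ∀ p : ℝ × ℝ × ℝ,
      a₁ • K₁ p + a₂ • K₂ p + a₃ • K₃ p + a₄ • K₄ p + a₅ • K₅ p + a₆ • K₆ p = 0) :
    a₁ = 0 ∧ a₂ = 0 ∧ a₃ = 0 ∧ a₄ = 0 ∧ a₅ = 0 ∧ a₆ = 0 := by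
  have h0 := hsum (0, 0, 0)
  have hx := hsum (1, 0, 0)
  have hy := hsum (0, 1, 0)
  simp only [hK₁, hK₂, hK₃, hK₄, hK₅, hK₆, Prod.smul_mk, Prod.mk_add_mk, smul_eq_mul,
    Prod.mk_eq_zero] at h0 hx hy
  obtain ⟨p1, p2, p3⟩ := h0
  obtain ⟨q1, q2, q3⟩ := hx
  obtain ⟨r1, r2, r3⟩ := hy
  have e4 : a₄ = 0 := by linarith
  have e5 : a₅ = 0 := by linarith
  have e6 : a₆ = 0 := by linarith
  subst e4 e5 e6
  refine ⟨?_, ?_, ?_, rfl, rfl, rfl⟩ <;> linarith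
end

section
/- Let α ∈ ℝ with α ≠ 0, c₁, c₂ ∈ ℝ with c₁² + c₂² > 0, c₃ > 0, and c₄ ∈ ℝ. Define z(t) = (1/(2α)) log( c₃² / ((c₁² + c₂²) cosh²(αc₃(t - c₄))) ). Then for all t ∈ ℝ: z'(t)² + (c₁² + c₂²) e^{2α z(t)} = c₃². -/
theorem geodesic_z_energy_integral (α c₁ c₂ c₃ c₄ : ℝ)
    (hα : α ≠ 0) (hc : c₁ ^ 2 + c₂ ^ 2 > 0) (hc₃ : c₃ > 0)
    (z : ℝ → ℝ)
    (hz : ∀ t, z t = 1 / (2 * α) *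
      Real.log (c₃ ^ 2 / ((c₁ ^ 2 + c₂ ^ 2) * Real.cosh (α * c₃ * (t - c₄)) ^ 2))) :
    ∀ t : ℝ,
      deriv z t ^ 2 + (c₁ ^ 2 + c₂ ^ 2) * Real.exp (2 * α * z t) = c₃ ^ 2 := by
  intro t
  have hA : c₁ ^ 2 + c₂ ^ 2 ≠ 0 := hc.ne'
  have hC : ∀ u : ℝ, Real.cosh u ≠ 0 := fun u => (Real.cosh_pos u).ne'
  have hz' : z = fun t => 1 / (2 * α) * (Real.log (c₃ ^ 2 / (c₁ ^ 2 + c₂ ^ 2)) -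
      2 * Real.log (Real.cosh (α * c₃ * (t - c₄)))) := by
    funext s
    rw [hz s, ← div_div (c₃ ^ 2), Real.log_div (div_ne_zero (pow_ne_zero 2 hc₃.ne') hA)
      (pow_ne_zero 2 (hC _)), Real.log_pow]
    norm_num
  have h1 : HasDerivAt (fun t => α * c₃ * (t - c₄)) (α * c₃ * 1) t :=
    ((hasDerivAt_id t).sub_const c₄).const_mul (α * c₃)
  have h2 := (((h1.cosh.log (hC _)).const_mul 2).const_sub
    (Real.log (c₃ ^ 2 / (c₁ ^ 2 + c₂ ^ 2)))).const_mul (1 / (2 * α))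
  rw [← hz'] at h2
  have h3 := h2.deriv
  clear hz' h2 h1
  have h4 : Real.exp (2 * α * z t) =
      c₃ ^ 2 / ((c₁ ^ 2 + c₂ ^ 2) * Real.cosh (α * c₃ * (t - c₄)) ^ 2) := by
    have e : 2 * α * z t = Real.log
        (c₃ ^ 2 / ((c₁ ^ 2 + c₂ ^ 2) * Real.cosh (α * c₃ * (t - c₄)) ^ 2)) := by
      rw [hz t]
      field_simp
    have := Real.cosh_pos (α * c₃ * (t - c₄))
    rw [e, Real.exp_log (by positivity)]
  rw [h3, h4]
  have h5 := Real.cosh_sq (α * c₃ * (t - c₄))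
  have h6 := hC (α * c₃ * (t - c₄))
  generalize Real.cosh (α * c₃ * (t - c₄)) = C at *
  generalize Real.sinh (α * c₃ * (t - c₄)) = S at *
  field_simp
  linear_combination -h5
end

section
/- Let α ∈ ℝ with α ≠ 0, B₁ ∈ ℝ, and let x, y, z : ℝ → ℝ be twice differentiable functions satisfying, for all t, the Lorentz equations for the Killing magnetic field B₁K₁ on H³(-α²): x''(t) - 2α x'(t) z'(t) = 0, y''(t) - 2α y'(t) z'(t) = -B₁ z'(t), and z''(t) + α (x'(t)² + y'(t)²) e^{-2α z(t)} = B₁ y'(t) e^{-2α z(t)}. Then: (i) the function t ↦ x'(t) e^{-2α z(t)} is constant, with value say c₁; (ii) the function t ↦ (y'(t) - B₁/(2α)) e^{-2α z(t)} is constant, with value say c₂; and (iii) the function t ↦ z'(t)² + (c₁² + c₂²) e^{2α z(t)} + (B₁²/(4α²)) e^{-2α z(t)} is constant. -/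
theorem K1_magnetic_first_integrals (α B₁ : ℝ) (hα : α ≠ 0) (x y z : ℝ → ℝ)
    (hx : Differentiable ℝ x) (hx' : Differentiable ℝ (deriv x))
    (hy : Differentiable ℝ y) (hy' : Differentiable ℝ (deriv y))
    (hz : Differentiable ℝ z) (hz' : Differentiable ℝ (deriv z))
    (hlorentz : ∀ t : ℝ,
      deriv (deriv x) t - 2 * α * deriv x t * deriv z t = 0 ∧
      deriv (deriv y) t - 2 * α * deriv y t * deriv z t = -B₁ * deriv z t ∧
      deriv (deriv z) t +
        α * (deriv x t ^ 2 + deriv y t ^ 2) * Real.exp (-2 * α * z t) =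
        B₁ * deriv y t * Real.exp (-2 * α * z t)) :
    ∃ c₁ c₂ : ℝ,
      (∀ t : ℝ, deriv x t * Real.exp (-2 * α * z t) = c₁) ∧
      (∀ t : ℝ, (deriv y t - B₁ / (2 * α)) * Real.exp (-2 * α * z t) = c₂) ∧
      (∀ s t : ℝ,
        deriv z s ^ 2 + (c₁ ^ 2 + c₂ ^ 2) * Real.exp (2 * α * z s) +
          B₁ ^ 2 / (4 * α ^ 2) * Real.exp (-2 * α * z s) =
        deriv z t ^ 2 + (c₁ ^ 2 + c₂ ^ 2) * Real.exp (2 * α * z t) +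
          B₁ ^ 2 / (4 * α ^ 2) * Real.exp (-2 * α * z t)) := by
  have hE : ∀ t, HasDerivAt (fun t => Real.exp (-2 * α * z t))
      (Real.exp (-2 * α * z t) * (-2 * α * deriv z t)) t := fun t =>
    ((hz t).hasDerivAt.const_mul (-2 * α)).exp
  have hF : ∀ t, HasDerivAt (fun t => Real.exp (2 * α * z t))
      (Real.exp (2 * α * z t) * (2 * α * deriv z t)) t := fun t =>
    ((hz t).hasDerivAt.const_mul (2 * α)).exp
  have hEF : ∀ t, Real.exp (-2 * α * z t) * Real.exp (2 * α * z t) = 1 := by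
    intro t
    rw [← Real.exp_add]
    ring_nf
    exact Real.exp_zero
  have key : ∀ f : ℝ → ℝ, (∀ t, HasDerivAt f 0 t) → ∀ s t, f s = f t := fun f hf =>
    is_const_of_deriv_eq_zero (fun t => (hf t).differentiableAt) (fun t => (hf t).deriv)
  obtain ⟨b, hb⟩ : ∃ b, b = B₁ / (2 * α) := ⟨_, rfl⟩
  have hB : B₁ = 2 * α * b := by rw [hb]; field_simp
  have hb2 : B₁ ^ 2 / (4 * α ^ 2) = b ^ 2 := by rw [hb]; field_simp; norm_num
  rw [hb2, ← hb]
  have h1 := key (fun t => deriv x t * Real.exp (-2 * α * z t)) (fun t => by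
    refine ((hx' t).hasDerivAt.mul (hE t)).congr_deriv ?_
    linear_combination Real.exp (-2 * α * z t) * (hlorentz t).1)
  have h2 := key (fun t => (deriv y t - b) * Real.exp (-2 * α * z t)) (fun t => by
    refine (((hy' t).hasDerivAt.sub_const b).mul (hE t)).congr_deriv ?_
    linear_combination Real.exp (-2 * α * z t) * (hlorentz t).2.1
      - Real.exp (-2 * α * z t) * deriv z t * hB)
  refine ⟨_, _, fun t => h1 t 0, fun t => h2 t 0, ?_⟩
  refine key (fun t => deriv z t ^ 2 + _ * Real.exp (2 * α * z t) +
    b ^ 2 * Real.exp (-2 * α * z t)) (fun t => ?_)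
  refine ((((hz' t).hasDerivAt.pow 2).add ((hF t).const_mul _)).add
    ((hE t).const_mul _)).congr_deriv ?_
  rw [← h1 t 0, ← h2 t 0]
  have h3 := (hlorentz t).2.2
  have h4 := hEF t
  simp only [hB] at h3
  generalize Real.exp (-2 * α * z t) = E at *
  generalize Real.exp (2 * α * z t) = F at *
  push_cast
  linear_combination 2 * deriv z t * h3 +
    2 * α * deriv z t * E * (deriv x t ^ 2 + (deriv y t - b) ^ 2) * h4
end

section
/- Let α ∈ ℝ with α ≠ 0, c₁, c₂ ∈ ℝ with c₁² + c₂² > 0, c₃ > 0, and c₄, c₇, c₈, c₉ ∈ ℝ. Define z₀(t) = (1/(2α)) log( c₃² / ((c₁² + c₂²) cosh²(αc₃(t - c₄))) ), z₁(t) = c₇ tanh(αc₃(t - c₄)), x₁(t) = -(c₁c₃c₇/(c₁² + c₂²)) sech²(αc₃(t - c₄)) + c₈, and y₁(t) = -(c₂c₃c₇/(c₁² + c₂²)) sech²(αc₃(t - c₄)) + (t - c₄)/(2α) + c₉, where sech u = 1/cosh u. Then for all t ∈ ℝ: z₀'(t) z₁'(t) + α(c₁² + c₂²) e^{2α z₀(t)}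 z₁(t) = 0, x₁'(t) = 2α c₁ e^{2α z₀(t)} z₁(t), and y₁'(t) = 2α c₂ e^{2α z₀(t)} z₁(t) + 1/(2α). -/
theorem K1_magnetic_first_order_solution (α c₁ c₂ c₃ c₄ c₇ c₈ c₉ : ℝ)
    (hα : α ≠ 0) (hc : c₁ ^ 2 + c₂ ^ 2 > 0) (hc₃ : c₃ > 0)
    (z₀ z₁ x₁ y₁ : ℝ → ℝ)
    (hz₀ : ∀ t, z₀ t = 1 / (2 * α) *
      Real.log (c₃ ^ 2 / ((c₁ ^ 2 + c₂ ^ 2) * Real.cosh (α * c₃ * (t - c₄)) ^ 2)))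
    (hz₁ : ∀ t, z₁ t = c₇ * Real.tanh (α * c₃ * (t - c₄)))
    (hx₁ : ∀ t, x₁ t = -(c₁ * c₃ * c₇ / (c₁ ^ 2 + c₂ ^ 2)) *
      (1 / Real.cosh (α * c₃ * (t - c₄))) ^ 2 + c₈)
    (hy₁ : ∀ t, y₁ t = -(c₂ * c₃ * c₇ / (c₁ ^ 2 + c₂ ^ 2)) *
      (1 / Real.cosh (α * c₃ * (t - c₄))) ^ 2 + (t - c₄) / (2 * α) + c₉) :
    ∀ t : ℝ,
      deriv z₀ t * deriv z₁ t +
        α * (c₁ ^ 2 + c₂ ^ 2) * Real.exp (2 * α * z₀ t) * z₁ t = 0 ∧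
      deriv x₁ t = 2 * α * c₁ * Real.exp (2 * α * z₀ t) * z₁ t ∧
      deriv y₁ t = 2 * α * c₂ * Real.exp (2 * α * z₀ t) * z₁ t + 1 / (2 * α) := by
  intro t
  have hC : c₁ ^ 2 + c₂ ^ 2 ≠ 0 := hc.ne'
  have hp : ∀ s : ℝ, Real.cosh (α * c₃ * (s - c₄)) ≠ 0 := fun s => (Real.cosh_pos _).ne'
  have hu : HasDerivAt (fun s : ℝ => α * c₃ * (s - c₄)) (α * c₃) t := by
    simpa using ((hasDerivAt_id t).sub_const c₄).const_mul (α * c₃)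
  have hch := hu.cosh
  have hsh := hu.sinh
  have hexp : Real.exp (2 * α * z₀ t) =
      c₃ ^ 2 / ((c₁ ^ 2 + c₂ ^ 2) * Real.cosh (α * c₃ * (t - c₄)) ^ 2) := by
    have h1 : 0 < c₃ ^ 2 / ((c₁ ^ 2 + c₂ ^ 2) * Real.cosh (α * c₃ * (t - c₄)) ^ 2) := by
      have := Real.cosh_pos (α * c₃ * (t - c₄))
      positivity
    rw [hz₀ t, ← mul_assoc, mul_one_div_cancel (by simpa using hα), one_mul, Real.exp_log h1]
  have hs : HasDerivAt (fun s : ℝ => (1 / Real.cosh (α * c₃ * (s - c₄))) ^ 2)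
      (-(2 * α * c₃ * Real.sinh (α * c₃ * (t - c₄)) / Real.cosh (α * c₃ * (t - c₄)) ^ 3)) t := by
    have h := (hch.fun_inv (hp t)).fun_pow 2
    simp only [one_div]
    refine h.congr_deriv ?_
    have := hp t
    norm_num
    field_simp
  have hdz₀ : HasDerivAt z₀
      (-(c₃ * Real.sinh (α * c₃ * (t - c₄)) / Real.cosh (α * c₃ * (t - c₄)))) t := by
    have e : z₀ = fun s => 1 / (2 * α) * (Real.log (c₃ ^ 2 / (c₁ ^ 2 + c₂ ^ 2))
        - 2 * Real.log (Real.cosh (α * c₃ * (s - c₄)))) := by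
      funext s
      rw [hz₀ s, ← div_div (c₃ ^ 2), Real.log_div (div_ne_zero (by positivity) hC) (pow_ne_zero 2 (hp s)),
        Real.log_pow]
      norm_num
    rw [e]
    refine ((((hch.log (hp t)).const_mul 2).const_sub _).const_mul _).congr_deriv ?_
    have := hp t
    field_simp
  have hdz₁ : HasDerivAt z₁ (c₇ * (α * c₃ / Real.cosh (α * c₃ * (t - c₄)) ^ 2)) t := by
    have e : z₁ = fun s => c₇ * (Real.sinh (α * c₃ * (s - c₄)) /
        Real.cosh (α * c₃ * (s - c₄))) := by
      funext s
      rw [hz₁ s, Real.tanh_eq_sinh_div_cosh]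
    rw [e]
    refine ((hsh.fun_div hch (hp t)).const_mul c₇).congr_deriv ?_
    have h1 := Real.cosh_sq (α * c₃ * (t - c₄))
    congr 2
    linear_combination (α * c₃) * h1
  have hdx := (hs.const_mul (-(c₁ * c₃ * c₇ / (c₁ ^ 2 + c₂ ^ 2)))).add_const c₈
  rw [← funext hx₁] at hdx
  have hl : HasDerivAt (fun s : ℝ => (s - c₄) / (2 * α)) (1 / (2 * α)) t :=
    ((hasDerivAt_id t).sub_const c₄).div_const (2 * α)
  have hdy := ((hs.const_mul (-(c₂ * c₃ * c₇ / (c₁ ^ 2 + c₂ ^ 2)))).fun_add hl).add_const c₉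
  rw [← funext hy₁] at hdy
  rw [hdz₀.deriv, hdz₁.deriv, hdx.deriv, hdy.deriv, hexp, hz₁ t, Real.tanh_eq_sinh_div_cosh]
  have := hp t
  refine ⟨?_, ?_, ?_⟩
  · field_simp
    ring
  · field_simp
  · congr 1
    field_simp
end

section
/- Let c₉, c₁₀ ∈ ℝ and define u(τ) = c₉ tanh(τ) + c₁₀ (1 - τ tanh(τ)) for τ ∈ ℝ. Then for all τ ∈ ℝ: cosh²(τ) · u''(τ) + 2 u(τ) = 0. -/
lemma aux_tanh_deriv (x : ℝ) : HasDerivAt Real.tanh (1 - Real.tanh x ^ 2) x := by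
  have hc : Real.cosh x ≠ 0 := (Real.cosh_pos x).ne'
  have h := (Real.hasDerivAt_sinh x).div (Real.hasDerivAt_cosh x) hc
  have e : Real.tanh = Real.sinh / Real.cosh := by
    funext y
    simp [Real.tanh_eq_sinh_div_cosh]
  rw [← e] at h
  refine h.congr_deriv ?_
  rw [Real.tanh_eq_sinh_div_cosh]
  field_simp

theorem homogeneous_z1_ode_solution (c₉ c₁₀ : ℝ) (u : ℝ → ℝ)
    (hu : ∀ τ : ℝ, u τ = c₉ * Real.tanh τ + c₁₀ * (1 - τ * Real.tanh τ)) :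
    ∀ τ : ℝ, Real.cosh τ ^ 2 * deriv (deriv u) τ + 2 * u τ = 0 := by
  intro τ
  have hu' : u = fun τ => c₉ * Real.tanh τ + c₁₀ * (1 - τ * Real.tanh τ) := funext hu
  have h1 : deriv u = fun τ => c₉ * (1 - Real.tanh τ ^ 2)
      - c₁₀ * (Real.tanh τ + τ * (1 - Real.tanh τ ^ 2)) := by
    funext x
    rw [hu']
    have hT := aux_tanh_deriv x
    have h := (hT.const_mul c₉).add ((((hasDerivAt_id' x).mul hT).const_sub 1).const_mul c₁₀)
    refine HasDerivAt.deriv (h.congr_deriv ?_)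
    ring
  have h2 : deriv (deriv u) τ = -2 * (1 - Real.tanh τ ^ 2) * u τ := by
    rw [h1, hu τ]
    have hT := aux_tanh_deriv τ
    have hS := (hT.pow 2).const_sub 1
    have h := (hS.const_mul c₉).sub ((hT.add ((hasDerivAt_id' τ).mul hS)).const_mul c₁₀)
    refine HasDerivAt.deriv (h.congr_deriv ?_)
    simp only [Pi.pow_apply]
    push_cast
    ring
  have h3 : Real.cosh τ ^ 2 * (1 - Real.tanh τ ^ 2) = 1 := by
    have hc : Real.cosh τ ≠ 0 := (Real.cosh_pos τ).ne'
    rw [Real.tanh_eq_sinh_div_cosh]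
    field_simp
    linarith [Real.cosh_sq τ]
  rw [h2]
  linear_combination (-2 * u τ) * h3
end

section
/- Let α ∈ ℝ with α ≠ 0, c₁, c₂ ∈ ℝ with c₁² + c₂² > 0, c₃ > 0, and c₄, c₇, c₈, c₉, c₁₀ ∈ ℝ. Define z₀(t) = (1/(2α)) log( c₃² / ((c₁² + c₂²) cosh²(αc₃(t - c₄))) ) and z₁(t) = -c₁₀ + (c₉ + αc₃c₁₀(t - c₄)) tanh(αc₃(t - c₄)) - (c₁c₇ + c₂c₈)/(α(c₁² + c₂²)). Then for all t ∈ ℝ: e^{-2α z₀(t)} · z₁''(t) + 2α²(c₁² + c₂²) z₁(t) = -2α(c₁c₇ + c₂c₈). -/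
theorem tanh_aux (k c t : ℝ) : HasDerivAt (fun t => Real.tanh (k * (t - c)))
    (k / Real.cosh (k * (t - c)) ^ 2) t := by
  have hu : HasDerivAt (fun t : ℝ => k * (t - c)) k t := by
    simpa using ((hasDerivAt_id t).sub_const c).const_mul k
  have hne := (Real.cosh_pos (k * (t - c))).ne'
  have h := hu.sinh.div hu.cosh hne
  have e : (fun t => Real.tanh (k * (t - c))) =
      (fun t => Real.sinh (k * (t - c))) / (fun t => Real.cosh (k * (t - c))) := by
    funext x
    simp [Real.tanh_eq_sinh_div_cosh]
  rw [e]
  refine h.congr_deriv ?_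
  congr 1
  linear_combination k * Real.cosh_sq_sub_sinh_sq (k * (t - c))

theorem K4_magnetic_z1_ode_solution (α c₁ c₂ c₃ c₄ c₇ c₈ c₉ c₁₀ : ℝ)
    (hα : α ≠ 0) (hc : c₁ ^ 2 + c₂ ^ 2 > 0) (hc₃ : c₃ > 0)
    (z₀ z₁ : ℝ → ℝ)
    (hz₀ : ∀ t, z₀ t = 1 / (2 * α) *
      Real.log (c₃ ^ 2 / ((c₁ ^ 2 + c₂ ^ 2) * Real.cosh (α * c₃ * (t - c₄)) ^ 2)))
    (hz₁ : ∀ t, z₁ t = -c₁₀ +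
      (c₉ + α * c₃ * c₁₀ * (t - c₄)) * Real.tanh (α * c₃ * (t - c₄)) -
      (c₁ * c₇ + c₂ * c₈) / (α * (c₁ ^ 2 + c₂ ^ 2))) :
    ∀ t : ℝ, Real.exp (-2 * α * z₀ t) * deriv (deriv z₁) t +
      2 * α ^ 2 * (c₁ ^ 2 + c₂ ^ 2) * z₁ t = -2 * α * (c₁ * c₇ + c₂ * c₈) := by
  intro t
  have hL : ∀ t : ℝ, HasDerivAt (fun t => c₉ + α * c₃ * c₁₀ * (t - c₄)) (α * c₃ * c₁₀) t := by
    intro t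
    simpa using (((hasDerivAt_id t).sub_const c₄).const_mul (α * c₃ * c₁₀)).const_add c₉
  have h1 : deriv z₁ = fun t => α * c₃ * c₁₀ * Real.tanh (α * c₃ * (t - c₄)) +
      (c₉ + α * c₃ * c₁₀ * (t - c₄)) * (α * c₃ / Real.cosh (α * c₃ * (t - c₄)) ^ 2) := by
    funext t
    rw [funext hz₁]
    exact ((((hL t).mul (tanh_aux (α * c₃) c₄ t)).const_add (-c₁₀)).sub_const _).deriv
  have hne := (Real.cosh_pos (α * c₃ * (t - c₄))).ne'
  have hu : HasDerivAt (fun t : ℝ => α * c₃ * (t - c₄)) (α * c₃) t := by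
    simpa using ((hasDerivAt_id t).sub_const c₄).const_mul (α * c₃)
  have hS := (hasDerivAt_const t (α * c₃)).fun_div (hu.cosh.fun_pow 2) (pow_ne_zero 2 hne)
  have h2 := (((tanh_aux (α * c₃) c₄ t).const_mul (α * c₃ * c₁₀)).fun_add ((hL t).fun_mul hS)).deriv
  have hE : Real.exp (-2 * α * z₀ t) =
      (c₁ ^ 2 + c₂ ^ 2) * Real.cosh (α * c₃ * (t - c₄)) ^ 2 / c₃ ^ 2 := by
    have hp : 0 < c₃ ^ 2 / ((c₁ ^ 2 + c₂ ^ 2) * Real.cosh (α * c₃ * (t - c₄)) ^ 2) := by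
      have := Real.cosh_pos (α * c₃ * (t - c₄))
      positivity
    have e : -2 * α * z₀ t =
        -Real.log (c₃ ^ 2 / ((c₁ ^ 2 + c₂ ^ 2) * Real.cosh (α * c₃ * (t - c₄)) ^ 2)) := by
      rw [hz₀]
      field_simp
    rw [e, Real.exp_neg, Real.exp_log hp, inv_div]
  rw [h1, h2, hE, hz₁, Real.tanh_eq_sinh_div_cosh]
  generalize Real.cosh (α * c₃ * (t - c₄)) = C at *
  generalize Real.sinh (α * c₃ * (t - c₄)) = S at *
  have hc' := hc.ne'
  have hc3 := hc₃.ne'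
  generalize c₁ ^ 2 + c₂ ^ 2 = Q at *
  field_simp
  ring
end
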